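/- arXiv:2211.05566 — 7 statements merged into one kernel-verified Lean document; each statement's English description precedes it below -/
import Mathlib

section
/- Suppose A ∈ ℂ^{n×n} is in Jordan canonical form with every eigenvalue of geometric multiplicity 1. Then for each sensor i, the row space of the observability matrix O_i, i.e., span{ (C_i A^{k-1})ᴴ : k = 1,…,n }, equals span{ e_j : j ∈ Q_i }, where e_j is the j-th canonical basis vector. Consequently, with H_i the selection matrix for Q_i, H_iᴴ H_i x = x for every x in the row space of O_i, and H_iᴴ H_i x = 0 for every x ∈ ℂ^n whose j-th entry vanishes for all j ∈ Q_i. -/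
open Matrix

/-- The observability matrix of the pair `(A, c)` (row `k` is `c · A^k`, `k = 0,…,n-1`). -/
noncomputable def obsMat {n : ℕ} (A : Matrix (Fin n) (Fin n) ℂ) (c : Fin n → ℂ) :
    Matrix (Fin n) (Fin n) ℂ :=
  Matrix.of fun k j => Matrix.vecMul c (A ^ (k : ℕ)) j

/-- The set of indices of nonzero columns of a matrix. -/
noncomputable def colSupport {r n : ℕ} (M : Matrix (Fin r) (Fin n) ℂ) : Finset (Fin n) :=
  @Finset.filter _ (fun j => ∃ k, M k j ≠ 0) (Classical.decPred _) Finset.univ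

/-- The selection matrix of `Q ⊆ {1,…,n}`: its rows are the transposed canonical basis
vectors `e_jᵀ`, `j ∈ Q`, listed in increasing order of `j`. -/
def selMatrix {n d : ℕ} (Q : Finset (Fin n)) (h : Q.card = d) :
    Matrix (Fin d) (Fin n) ℂ :=
  Matrix.of fun k j => if j = (Q.orderIsoOfFin h k : Fin n) then 1 else 0

/-- The row space of `M`: the span of the conjugate transposes of the rows of `M`. -/
noncomputable def rowSpan {r n : ℕ} (M : Matrix (Fin r) (Fin n) ℂ) : Submodule ℂ (Fin n → ℂ) :=
  Submodule.span ℂ (Set.range fun k j => star (M k j))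

/-- `A` is in Jordan canonical form with every eigenvalue of geometric multiplicity 1:
`A` is upper bidiagonal, each superdiagonal entry is 0 or 1, a superdiagonal 1 forces equal
adjacent diagonal entries, and equal diagonal entries at positions `j < j'` force all
superdiagonal entries in between to be 1. -/
def IsJordanGM1 {n : ℕ} (A : Matrix (Fin n) (Fin n) ℂ) : Prop :=
  (∀ j j' : Fin n, (j' : ℕ) ≠ (j : ℕ) → (j' : ℕ) ≠ (j : ℕ) + 1 → A j j' = 0) ∧
  (∀ j j' : Fin n, (j' : ℕ) = (j : ℕ) + 1 → A j j' = 0 ∨ A j j' = 1) ∧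
  (∀ j j' : Fin n, (j' : ℕ) = (j : ℕ) + 1 → A j j' = 1 → A j j = A j' j') ∧
  (∀ j j' : Fin n, j < j' → A j j = A j' j' →
    ∀ k k' : Fin n, j ≤ k → (k' : ℕ) = (k : ℕ) + 1 → k' ≤ j' → A k k' = 1)

namespace IsJordanGM1

variable {n : ℕ} {A : Matrix (Fin n) (Fin n) ℂ}

theorem map_star (hA : IsJordanGM1 A) : IsJordanGM1 (A.map star) := by
  obtain ⟨h₁, h₂, h₃, h₄⟩ := hA
  refine ⟨fun j j' h h' => by simp [h₁ j j' h h'], fun j j' h => ?_, fun j j' h h' => ?_,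
    fun j j' h h' k k' hk hkk hk' => ?_⟩
  · rcases h₂ j j' h with h | h <;> simp [h]
  · have : A j j' = 1 := star_injective (by simpa using h')
    simp [h₃ j j' h this]
  · simp [h₄ j j' h (star_injective (by simpa using h')) k k' hk hkk hk']

theorem vecMul_apply_of_pred (hA : IsJordanGM1 A) (v : Fin n → ℂ) {j : Fin n}
    (h : ∀ i : Fin n, (j : ℕ) = i + 1 → v i * A i j = 0) :
    (v ᵥ* A) j = v j * A j j := by
  rw [Matrix.vecMul, dotProduct]
  refine Finset.sum_eq_single j (fun i _ hij => ?_) (by simp)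
  by_cases hi : (j : ℕ) = i + 1
  · exact h i hi
  · rw [hA.1 i j (fun h => hij (Fin.ext h.symm)) hi, mul_zero]

theorem vecMul_apply_succ (hA : IsJordanGM1 A) (v : Fin n → ℂ) {i j : Fin n}
    (h : (j : ℕ) = i + 1) : (v ᵥ* A) j = v i * A i j + v j * A j j := by
  have hij : i ≠ j := by rintro rfl; omega
  rw [Matrix.vecMul, dotProduct, Fintype.sum_eq_add i j hij]
  rintro k ⟨hki, hkj⟩
  rw [hA.1 k j (fun h' => hkj (Fin.ext h'.symm)) (fun h' => hki (Fin.ext (by omega))), mul_zero]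

/-- If `v A - μ v` vanishes outside the block of `μ`, then so does `v`. -/
theorem apply_eq_zero_of_vecMul_sub (hA : IsJordanGM1 A) {μ : ℂ} {v : Fin n → ℂ}
    (h : ∀ j, A j j ≠ μ → (v ᵥ* A) j - μ * v j = 0) (j : Fin n) (hj : A j j ≠ μ) : v j = 0 := by
  induction j using WellFoundedLT.induction with
  | ind j ih =>
    have hj' := h j hj
    rw [hA.vecMul_apply_of_pred v fun i hi => ?_] at hj'
    · have : v j * (A j j - μ) = 0 := by linear_combination hj'
      exact (mul_eq_zero.1 this).resolve_right (sub_ne_zero.2 hj)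
    · rcases hA.2.1 i j hi with h0 | h1
      · rw [h0, mul_zero]
      · rw [ih i (Fin.lt_def.2 (by omega)) (by rwa [hA.2.2.1 i j hi h1]), zero_mul]

theorem apply_eq_zero_of_mem_maxGenEigenspace (hA : IsJordanGM1 A) {μ : ℂ} {v : Fin n → ℂ}
    (hv : v ∈ Module.End.maxGenEigenspace A.vecMulLinear μ) (j : Fin n) (hj : A j j ≠ μ) :
    v j = 0 := by
  obtain ⟨k, hk⟩ := (Module.End.mem_maxGenEigenspace _ _ _).1 hv
  clear hv
  induction k generalizing v j with
  | zero => simpa using congrFun hk j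
  | succ k ih =>
    refine hA.apply_eq_zero_of_vecMul_sub (fun i hi => ?_) j hj
    rw [pow_succ, Module.End.mul_apply] at hk
    simpa using ih i hi hk

/-- An invariant subspace containing a vector of the block of `μ` with first nonzero entry `f`
contains all canonical basis vectors of that block from `f` on. -/
theorem single_mem_of_first (hA : IsJordanGM1 A) {W : Submodule ℂ (Fin n → ℂ)}
    (hW : ∀ w ∈ W, w ᵥ* A ∈ W) {μ : ℂ} (f : Fin n) {v : Fin n → ℂ} (hv : v ∈ W)
    (hμ : ∀ j, A j j ≠ μ → v j = 0) (hlt : ∀ k < f, v k = 0) (hf : v f ≠ 0)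
    {k : Fin n} (hk : f ≤ k) (hkμ : A k k = μ) : Pi.single k 1 ∈ W := by
  induction f using WellFoundedGT.induction generalizing v k with
  | ind f ih =>
    have hfμ : A f f = μ := by_contra fun h => hf (hμ f h)
    have key : ∀ k, f < k → A k k = μ → (Pi.single k 1 : Fin n → ℂ) ∈ W := by
      intro k hfk hkμ
      let g : Fin n := ⟨f + 1, by have := Fin.lt_def.1 hfk; omega⟩
      have hfg : (g : ℕ) = f + 1 := rfl
      have hgk : g ≤ k := Fin.le_def.2 (by have := Fin.lt_def.1 hfk; omega)
      have h1 : A f g = 1 := hA.2.2.2 f k hfk (hfμ.trans hkμ.symm) f g le_rfl hfg hgk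
      have hgμ : A g g = μ := (hA.2.2.1 f g hfg h1).symm.trans hfμ
      refine ih g (Fin.lt_def.2 (by omega)) (v := v ᵥ* A - μ • v)
        (W.sub_mem (hW v hv) (W.smul_mem μ hv)) (fun j hj => ?_) (fun j hj => ?_) ?_ hgk hkμ
      · rw [Pi.sub_apply, Pi.smul_apply, hA.vecMul_apply_of_pred v fun i hi => ?_, hμ j hj]
        · simp
        · rcases hA.2.1 i j hi with h0 | h1
          · rw [h0, mul_zero]
          · rw [hμ i (by rwa [hA.2.2.1 i j hi h1]), zero_mul]
      · have hjf : (j : ℕ) ≤ f := by have := Fin.lt_def.1 hj; omega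
        rw [Pi.sub_apply, Pi.smul_apply, hA.vecMul_apply_of_pred v fun i hi => by
          rw [hlt i (Fin.lt_def.2 (by omega)), zero_mul]]
        rcases hjf.lt_or_eq with h | h
        · rw [hlt j h]; simp
        · rw [Fin.ext h, hfμ, smul_eq_mul]; ring
      · rw [Pi.sub_apply, Pi.smul_apply, hA.vecMul_apply_succ v hfg, h1, hgμ, smul_eq_mul]
        intro h
        exact hf (by linear_combination h)
    rcases hk.lt_or_eq with h | rfl
    · exact key k h hkμ
    · have hsum : v = ∑ j, v j • (Pi.single j 1 : Fin n → ℂ) := pi_eq_sum_univ' v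
      rw [← Finset.add_sum_erase _ _ (Finset.mem_univ f)] at hsum
      have hrest : ∑ j ∈ Finset.univ.erase f, v j • (Pi.single j 1 : Fin n → ℂ) ∈ W := by
        refine W.sum_mem fun j hj => ?_
        rcases lt_or_gt_of_ne (Finset.ne_of_mem_erase hj) with h | h
        · simp [hlt j h]
        · by_cases hjμ : A j j = μ
          · exact W.smul_mem _ (key j h hjμ)
          · simp [hμ j hjμ]
      have := (W.add_mem_iff_left hrest).1 (hsum ▸ hv)
      exact (W.smul_mem_iff hf).1 this

/-- A subspace invariant under `v ↦ v A` contains every canonical basis vector in the support of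
one of its elements. -/
theorem single_mem (hA : IsJordanGM1 A) {W : Submodule ℂ (Fin n → ℂ)}
    (hW : ∀ w ∈ W, w ᵥ* A ∈ W) {w : Fin n → ℂ} (hw : w ∈ W) {j : Fin n} (hj : w j ≠ 0) :
    Pi.single j 1 ∈ W := by
  have hW' := Submodule.eq_iSup_inf_genEigenspace (f := A.vecMulLinear) (p := W) ⊤ hW
    (Module.End.iSup_maxGenEigenspace_eq_top _)
  have hw' := hW' ▸ hw
  revert hj
  refine Submodule.iSup_induction _ (motive := fun v => v j ≠ 0 → Pi.single j 1 ∈ W) hw'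
    (fun μ v hv hj => ?_) (by simp) (fun x y hx hy hj => ?_)
  · have hμ := hA.apply_eq_zero_of_mem_maxGenEigenspace hv.2
    obtain ⟨f, hf, hmin⟩ := WellFounded.has_min (wellFounded_lt (α := Fin n)) {k | v k ≠ 0} ⟨j, hj⟩
    exact hA.single_mem_of_first hW f hv.1 hμ (fun k hk => by_contra fun h => hmin k h hk) hf
      (not_lt.1 (hmin j hj)) (by_contra fun h => hj (hμ j h))
  · by_cases h : x j = 0
    · exact hy (by simpa [h] using hj)
    · exact hx h

end IsJordanGM1

theorem star_obsMat {n : ℕ} (A : Matrix (Fin n) (Fin n) ℂ) (c : Fin n → ℂ) (k : Fin n) :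
    (fun j => star (obsMat A c k j)) = star c ᵥ* A.map star ^ (k : ℕ) := by
  ext j
  have h : A.map star ^ (k : ℕ) = (A ^ (k : ℕ)).map star :=
    (map_pow (starRingEnd ℂ).mapMatrix A k).symm
  rw [h]
  simp [obsMat, Matrix.vecMul, dotProduct]

theorem rowSpan_obsMat {n : ℕ} (A : Matrix (Fin n) (Fin n) ℂ) (c : Fin n → ℂ) :
    rowSpan (obsMat A c) =
      Submodule.span ℂ (Set.range fun k : Fin n => star c ᵥ* A.map star ^ (k : ℕ)) :=
  congrArg (fun f => Submodule.span ℂ (Set.range f)) (funext (star_obsMat A c))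

theorem vecMul_pow_mem_span {n : ℕ} (A : Matrix (Fin n) (Fin n) ℂ) (c : Fin n → ℂ) (k : ℕ) :
    c ᵥ* A ^ k ∈ Submodule.span ℂ (Set.range fun l : Fin n => c ᵥ* A ^ (l : ℕ)) := by
  rcases Nat.eq_zero_or_pos n with rfl | hn
  · rw [Subsingleton.elim (c ᵥ* A ^ k) 0]
    exact Submodule.zero_mem _
  have hdeg : (Polynomial.X ^ k %ₘ A.charpoly).natDegree < n := by
    have h := Polynomial.natDegree_modByMonic_lt (Polynomial.X ^ k) A.charpoly_monic fun h => by
      have := A.charpoly_natDegree_eq_dim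
      simp [h] at this
      omega
    simpa [A.charpoly_natDegree_eq_dim] using h
  rw [A.pow_eq_aeval_mod_charpoly k, Polynomial.aeval_eq_sum_range' hdeg, Matrix.vecMul_sum]
  refine Submodule.sum_mem _ fun l hl => ?_
  rw [Matrix.vecMul_smul]
  exact Submodule.smul_mem _ _ (Submodule.subset_span ⟨⟨l, Finset.mem_range.1 hl⟩, rfl⟩)

theorem vecMul_mem_rowSpan_obsMat {n : ℕ} (A : Matrix (Fin n) (Fin n) ℂ) (c : Fin n → ℂ)
    {w : Fin n → ℂ} (hw : w ∈ rowSpan (obsMat A c)) : w ᵥ* A.map star ∈ rowSpan (obsMat A c) := by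
  rw [rowSpan_obsMat] at hw ⊢
  induction hw using Submodule.span_induction with
  | mem x hx =>
    obtain ⟨k, rfl⟩ := hx
    rw [Matrix.vecMul_vecMul, ← pow_succ]
    exact vecMul_pow_mem_span _ _ _
  | zero => simp
  | add x y _ _ hx hy => rw [Matrix.add_vecMul]; exact Submodule.add_mem _ hx hy
  | smul a x _ hx => rw [Matrix.smul_vecMul]; exact Submodule.smul_mem _ a hx

theorem mem_colSupport {r n : ℕ} {M : Matrix (Fin r) (Fin n) ℂ} {j : Fin n} :
    j ∈ colSupport M ↔ ∃ k, M k j ≠ 0 := by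
  simp [colSupport]

theorem apply_eq_zero_of_mem_rowSpan {r n : ℕ} {M : Matrix (Fin r) (Fin n) ℂ} {x : Fin n → ℂ}
    (hx : x ∈ rowSpan M) {j : Fin n} (hj : j ∉ colSupport M) : x j = 0 := by
  have h : rowSpan M ≤ LinearMap.ker (LinearMap.proj j : (Fin n → ℂ) →ₗ[ℂ] ℂ) := by
    refine Submodule.span_le.2 ?_
    rintro _ ⟨k, rfl⟩
    have : M k j = 0 := by_contra fun h => hj (mem_colSupport.2 ⟨k, h⟩)
    simp [this]
  exact h hx

theorem conjTranspose_mul_selMatrix_mulVec {n d : ℕ} (Q : Finset (Fin n)) (h : Q.card = d)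
    (x : Fin n → ℂ) :
    ((selMatrix Q h)ᴴ * selMatrix Q h) *ᵥ x = fun j => if j ∈ Q then x j else 0 := by
  have hsel : selMatrix Q h *ᵥ x = fun k => x (Q.orderIsoOfFin h k) := by
    ext k
    simp only [selMatrix, Matrix.mulVec, dotProduct, Matrix.of_apply, ite_mul, one_mul, zero_mul,
      Finset.sum_ite_eq', Finset.mem_univ, if_true]
  ext j
  rw [← Matrix.mulVec_mulVec, hsel]
  simp only [Matrix.mulVec, dotProduct, Matrix.conjTranspose_apply, selMatrix, Matrix.of_apply]
  refine (Equiv.sum_comp (Q.orderIsoOfFin h).toEquiv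
    fun q : Q => star (if j = (q : Fin n) then (1 : ℂ) else 0) * x q).trans ?_
  rw [Finset.sum_coe_sort Q fun q => star (if j = q then (1 : ℂ) else 0) * x q]
  simp [apply_ite star]

/-- if `A` is in Jordan form with all eigenvalues of geometric multiplicity 1,
then the row space of `O_i` equals `span{e_j : j ∈ Q_i}`; consequently `H_iᴴ H_i x = x` for
`x` in the row space of `O_i`, and `H_iᴴ H_i x = 0` whenever `x_j = 0` for all `j ∈ Q_i`. -/
theorem stmt1 {n m : ℕ} (A : Matrix (Fin n) (Fin n) ℂ) (hA : IsJordanGM1 A)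
    (C : Matrix (Fin m) (Fin n) ℂ) (i : Fin m) :
    rowSpan (obsMat A (C i))
      = Submodule.span ℂ
          ((fun j => (Pi.single j 1 : Fin n → ℂ)) '' (colSupport (obsMat A (C i)) : Set (Fin n))) ∧
    (∀ x ∈ rowSpan (obsMat A (C i)),
      ((selMatrix (colSupport (obsMat A (C i))) rfl)ᴴ
        * selMatrix (colSupport (obsMat A (C i))) rfl).mulVec x = x) ∧
    (∀ x : Fin n → ℂ, (∀ j ∈ colSupport (obsMat A (C i)), x j = 0) →
      ((selMatrix (colSupport (obsMat A (C i))) rfl)ᴴ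
        * selMatrix (colSupport (obsMat A (C i))) rfl).mulVec x = 0) := by
  refine ⟨le_antisymm (fun x hx => ?_) (Submodule.span_le.2 ?_), fun x hx => ?_, fun x hx => ?_⟩
  · rw [pi_eq_sum_univ' x]
    refine Submodule.sum_mem _ fun j _ => ?_
    by_cases hj : j ∈ colSupport (obsMat A (C i))
    · exact Submodule.smul_mem _ _ (Submodule.subset_span ⟨j, hj, rfl⟩)
    · simp [apply_eq_zero_of_mem_rowSpan hx hj]
  · rintro _ ⟨j, hj, rfl⟩
    obtain ⟨k, hk⟩ := mem_colSupport.1 (Finset.mem_coe.1 hj)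
    exact hA.map_star.single_mem (fun _ => vecMul_mem_rowSpan_obsMat A (C i))
      (Submodule.subset_span ⟨k, rfl⟩) (star_ne_zero.2 hk)
  · rw [conjTranspose_mul_selMatrix_mulVec]
    ext j
    split_ifs with hj
    · rfl
    · exact (apply_eq_zero_of_mem_rowSpan hx hj).symm
  · rw [conjTranspose_mul_selMatrix_mulVec]
    ext j
    split_ifs with hj
    · exact hx j hj
    · rfl
end

section
/- Suppose A ∈ ℂ^{n×n} is in Jordan canonical form with every eigenvalue of geometric multiplicity 1. Then for each sensor i the nonzero columns of the observability matrix O_i, i.e., the family { O_i e_j : j ∈ Q_i }, are linearly independent over ℂ. -/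
open Matrix

/-- The unobservable subspace of the pair `(A, c)`. -/
def unobservable {n : ℕ} (A : Matrix (Fin n) (Fin n) ℂ) (c : Fin n → ℂ) :
    Submodule ℂ (Fin n → ℂ) where
  carrier := {v | ∀ k : ℕ, c ⬝ᵥ (A ^ k *ᵥ v) = 0}
  add_mem' {v w} hv hw k := by simp [mulVec_add, dotProduct_add, hv k, hw k]
  zero_mem' k := by simp
  smul_mem' a v hv k := by simp [mulVec_smul, dotProduct_smul, hv k]

section

variable {n : ℕ} {A : Matrix (Fin n) (Fin n) ℂ} {c : Fin n → ℂ}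

theorem mem_unobservable {v : Fin n → ℂ} :
    v ∈ unobservable A c ↔ ∀ k : ℕ, c ⬝ᵥ (A ^ k *ᵥ v) = 0 := Iff.rfl

theorem mulVec_mem_unobservable {v : Fin n → ℂ} (hv : v ∈ unobservable A c) :
    A *ᵥ v ∈ unobservable A c := fun k => by
  rw [mulVec_mulVec, ← pow_succ]
  exact hv (k + 1)

/-- By Cayley–Hamilton, the kernel of the observability matrix is the unobservable subspace. -/
theorem obsMat_mulVec_eq_zero_iff {v : Fin n → ℂ} :
    obsMat A c *ᵥ v = 0 ↔ v ∈ unobservable A c := by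
  have key (k : Fin n) : (obsMat A c *ᵥ v) k = c ⬝ᵥ (A ^ (k : ℕ) *ᵥ v) := by
    rw [dotProduct_mulVec]
    rfl
  refine ⟨fun h k => ?_, fun h => funext fun k => (key k).trans (h k)⟩
  have hdeg : (Polynomial.X ^ k %ₘ A.charpoly).degree < n := by
    have := Polynomial.degree_modByMonic_lt (Polynomial.X ^ k) A.charpoly_monic
    rwa [A.charpoly_degree_eq_dim, Fintype.card_fin] at this
  rw [pow_eq_aeval_mod_charpoly, Polynomial.aeval_eq_sum_range, sum_mulVec, dotProduct_sum]
  refine Finset.sum_eq_zero fun l _ => ?_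
  rw [smul_mulVec, dotProduct_smul]
  by_cases hl : l < n
  · rw [← key ⟨l, hl⟩, h]
    simp
  · rw [Polynomial.coeff_eq_zero_of_degree_lt
      (hdeg.trans_le (by exact_mod_cast not_lt.mp hl)), zero_smul]

theorem mem_colSupport_obsMat_iff {j : Fin n} :
    j ∈ colSupport (obsMat A c) ↔ Pi.single j 1 ∉ unobservable A c := by
  rw [← obsMat_mulVec_eq_zero_iff, mulVec_single_one, funext_iff]
  simp [colSupport]

namespace IsJordanGM1

theorem mulVec_apply_of_succ (hA : IsJordanGM1 A) (v : Fin n → ℂ) {j j' : Fin n}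
    (h : (j' : ℕ) = j + 1) : (A *ᵥ v) j = A j j * v j + A j j' * v j' := by
  have hne : j ≠ j' := fun e => by simp [e] at h
  rw [mulVec, dotProduct, ← Finset.sum_pair (f := fun k => A j k * v k) hne]
  refine (Finset.sum_subset (Finset.subset_univ _) fun k _ hk => ?_).symm
  simp only [Finset.mem_insert, Finset.mem_singleton, not_or, Fin.ext_iff] at hk
  rw [hA.1 j k hk.1 (by omega), zero_mul]

theorem mulVec_apply_of_last (hA : IsJordanGM1 A) (v : Fin n → ℂ) {j : Fin n}
    (h : n ≤ (j : ℕ) + 1) : (A *ᵥ v) j = A j j * v j := by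
  rw [mulVec, dotProduct]
  refine Finset.sum_eq_single j (fun k _ hk => ?_) (by simp)
  rw [hA.1 j k (by simpa [Fin.ext_iff] using hk) (by omega), zero_mul]

theorem single_mem_unobservable_of_succ (hA : IsJordanGM1 A) {j j' : Fin n}
    (h : (j' : ℕ) = j + 1) (h1 : A j j' = 1)
    (hj' : Pi.single j' 1 ∈ unobservable A c) : Pi.single j 1 ∈ unobservable A c := by
  have : (Pi.single j 1 : Fin n → ℂ) =
      A *ᵥ Pi.single j' 1 - A j' j' • Pi.single j' 1 := by
    rw [mulVec_single_one]
    ext k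
    by_cases hk : k = j
    · subst hk
      have : k ≠ j' := fun e => by simp [e] at h
      simp [h1, this]
    · by_cases hk' : k = j'
      · subst hk'
        simp [hk]
      · have h0 : A k j' = 0 :=
          hA.1 k j' (fun e => hk' (Fin.ext e.symm)) (fun e => hk (Fin.ext (by omega)))
        simp [hk, hk', h0]
  rw [this]
  exact sub_mem (mulVec_mem_unobservable hj') (Submodule.smul_mem _ _ hj')

theorem single_mem_unobservable_of_le (hA : IsJordanGM1 A) {i j : Fin n} (hij : i ≤ j)
    (h1 : ∀ k k' : Fin n, i ≤ k → (k' : ℕ) = k + 1 → k' ≤ j → A k k' = 1)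
    (hj : Pi.single j 1 ∈ unobservable A c) : Pi.single i 1 ∈ unobservable A c := by
  rcases hij.eq_or_lt with rfl | hlt
  · exact hj
  · rw [Fin.lt_def] at hlt
    let i' : Fin n := ⟨i + 1, by omega⟩
    have hi' : i' ≤ j := Fin.le_def.mpr hlt
    refine hA.single_mem_unobservable_of_succ (j' := i') rfl (h1 i i' le_rfl rfl hi') ?_
    exact hA.single_mem_unobservable_of_le hi' (fun k k' hk =>
      h1 k k' (le_trans (Fin.le_def.mpr (Nat.le_succ _)) hk)) hj
termination_by (j : ℕ) - i

/-- An eigenvector of the compression of `A` to the observable coordinates is a multiple of a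
standard basis vector. -/
theorem eq_of_apply_ne_zero (hA : IsJordanGM1 A) {v : Fin n → ℂ} {μ : ℂ}
    (hv : ∀ j, Pi.single j 1 ∈ unobservable A c → v j = 0)
    (hμ : ∀ j, Pi.single j 1 ∉ unobservable A c → (A *ᵥ v) j = μ * v j)
    {i j : Fin n} (hi : v i ≠ 0) (hj : v j ≠ 0) : i = j := by
  have hdiag (d : ℕ) : ∀ k : Fin n, n - k = d → v k ≠ 0 → A k k = μ := by
    induction d with
    | zero => intro k hk; omega
    | succ d ih =>
      intro k hk hvk
      have hev := hμ k (mt (hv k) hvk)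
      by_cases hlast : n ≤ (k : ℕ) + 1
      · rw [hA.mulVec_apply_of_last v hlast] at hev
        exact mul_right_cancel₀ hvk hev
      · let k' : Fin n := ⟨k + 1, by omega⟩
        rw [hA.mulVec_apply_of_succ v (j' := k') rfl] at hev
        by_cases h0 : A k k' * v k' = 0
        · rw [h0, add_zero] at hev
          exact mul_right_cancel₀ hvk hev
        · have h1 := (hA.2.1 k k' rfl).resolve_left (left_ne_zero_of_mul h0)
          rw [hA.2.2.1 k k' rfl h1]
          exact ih k' (by simp only [k']; omega) (right_ne_zero_of_mul h0)
  have hnot {i j : Fin n} (hi : v i ≠ 0) (hj : v j ≠ 0) : ¬ i < j := by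
    intro hij
    have hchain := hA.2.2.2 i j hij ((hdiag _ i rfl hi).trans (hdiag _ j rfl hj).symm)
    rw [Fin.lt_def] at hij
    let p : Fin n := ⟨j - 1, by omega⟩
    have hpj : (j : ℕ) = p + 1 := by simp only [p]; omega
    have hip : i ≤ p := by rw [Fin.le_def]; omega
    have h1 : A p j = 1 := hchain p j hip hpj le_rfl
    by_cases hp : Pi.single p 1 ∈ unobservable A c
    · refine hi (hv i (hA.single_mem_unobservable_of_le hip (fun k k' hk hk' hkj =>
        hchain k k' hk hk' (hkj.trans ?_)) hp))
      rw [Fin.le_def]; omega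
    · have hev := hμ p hp
      rw [hA.mulVec_apply_of_succ v hpj, hA.2.2.1 p j hpj h1, hdiag _ j rfl hj, h1] at hev
      exact hj (by simpa using hev)
  exact le_antisymm (not_lt.mp (hnot hj hi)) (not_lt.mp (hnot hi hj))

/-- An unobservable vector supported on observable coordinates vanishes. -/
theorem eq_zero_of_mem_unobservable (hA : IsJordanGM1 A) {v : Fin n → ℂ}
    (hv : v ∈ unobservable A c) (hsupp : ∀ j, Pi.single j 1 ∈ unobservable A c → v j = 0) :
    v = 0 := by
  classical
  let N : Submodule ℂ (Fin n → ℂ) :=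
    { carrier := {w | w ∈ unobservable A c ∧ ∀ j, Pi.single j 1 ∈ unobservable A c → w j = 0}
      add_mem' := fun ha hb =>
        ⟨add_mem ha.1 hb.1, fun j hj => by simp [ha.2 j hj, hb.2 j hj]⟩
      zero_mem' := ⟨zero_mem _, fun _ _ => rfl⟩
      smul_mem' := fun a _ hw =>
        ⟨Submodule.smul_mem _ a hw.1, fun j hj => by simp [hw.2 j hj]⟩ }
  let B : Module.End ℂ (Fin n → ℂ) := LinearMap.pi fun j =>
    if Pi.single j 1 ∈ unobservable A c then 0 else LinearMap.proj j ∘ₗ A.mulVecLin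
  have hB (w : Fin n → ℂ) (j : Fin n) :
      B w j = if Pi.single j 1 ∈ unobservable A c then 0 else (A *ᵥ w) j := by
    simp only [B, LinearMap.pi_apply]
    split_ifs <;> simp
  have hBN : ∀ w ∈ N, B w ∈ N := by
    intro w hw
    refine ⟨?_, fun j hj => by rw [hB, if_pos hj]⟩
    have hdiff : A *ᵥ w - B w ∈ unobservable A c := by
      rw [pi_eq_sum_univ' (A *ᵥ w - B w)]
      refine Submodule.sum_mem _ fun j _ => ?_
      by_cases hj : Pi.single j 1 ∈ unobservable A c
      · exact Submodule.smul_mem _ _ (by convert hj using 1)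
      · simp [hB, hj]
    simpa using sub_mem (mulVec_mem_unobservable hw.1) hdiff
  by_contra hv0
  have : Nontrivial N := ⟨⟨⟨v, hv, hsupp⟩, 0, fun h => hv0 (congrArg Subtype.val h)⟩⟩
  obtain ⟨μ, hμ⟩ := Module.End.exists_eigenvalue (B.restrict hBN)
  obtain ⟨⟨w, hwU, hw⟩, hev, hw0⟩ := hμ.exists_hasEigenvector
  have hBw : B w = μ • w := congrArg Subtype.val (Module.End.mem_eigenspace_iff.mp hev)
  have hAw (j : Fin n) (hj : Pi.single j 1 ∉ unobservable A c) : (A *ᵥ w) j = μ * w j := by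
    have := hB w j
    rw [if_neg hj, hBw] at this
    exact this.symm
  obtain ⟨j, hj⟩ := Function.ne_iff.mp (fun h => hw0 (Subtype.ext h) : w ≠ 0)
  have hsingle : (w j)⁻¹ • w = Pi.single j 1 := by
    ext k
    by_cases hk : k = j
    · subst hk
      simpa using inv_mul_cancel₀ hj
    · have : w k = 0 := by
        by_contra h
        exact hk (hA.eq_of_apply_ne_zero hw hAw h hj)
      simp [hk, this]
  exact hj (hw j (hsingle ▸ Submodule.smul_mem _ _ hwU))

end IsJordanGM1

end

/-- if `A` is in Jordan canonical form with every eigenvalue of geometric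
multiplicity 1, then for each sensor `i` the nonzero columns `{O_i e_j : j ∈ Q_i}` of the
observability matrix `O_i` are linearly independent over ℂ. -/
theorem stmt3 {n m : ℕ} (A : Matrix (Fin n) (Fin n) ℂ) (hA : IsJordanGM1 A)
    (C : Matrix (Fin m) (Fin n) ℂ) (i : Fin m) :
    LinearIndependent ℂ
      (fun j : (colSupport (obsMat A (C i)) : Set (Fin n)) => (obsMat A (C i))ᵀ (j : Fin n)) := by
  classical
  refine linearIndepOn_finset_iff.mpr fun f hf j hj => ?_
  let v : Fin n → ℂ := fun j => if j ∈ colSupport (obsMat A (C i)) then f j else 0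
  have hv : v ∈ unobservable A (C i) := by
    rw [← obsMat_mulVec_eq_zero_iff, ← hf, mulVec_eq_sum]
    simp [v, ite_smul, Finset.sum_ite_mem]
  have h0 := hA.eq_zero_of_mem_unobservable hv fun j hj =>
    if_neg fun h => mem_colSupport_obsMat_iff.mp h hj
  simpa [v, hj] using congrFun h0 j
end

section
/- Suppose A ∈ ℂ^{n×n} is in Jordan canonical form with every eigenvalue of geometric multiplicity 1. Then for each sensor i, with Ã_i := H_i A H_iᴴ, one has Ã_i H_i = H_i A. -/
open Matrix

/-- By Cayley–Hamilton, an entry that vanishes in `c · A^k` for all `k < n` vanishes for all `k`. -/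
theorem vecMul_pow_apply_eq_zero {n : ℕ} (A : Matrix (Fin n) (Fin n) ℂ) (c : Fin n → ℂ) (l : Fin n)
    (h : ∀ k < n, vecMul c (A ^ k) l = 0) (k : ℕ) : vecMul c (A ^ k) l = 0 := by
  have : Nonempty (Fin n) := ⟨l⟩
  have hdeg : (Polynomial.X ^ k %ₘ A.charpoly).natDegree < n := by
    have hne : A.charpoly ≠ 1 := fun h1 => by
      have := A.charpoly_natDegree_eq_dim
      rw [h1, Polynomial.natDegree_one, Fintype.card_fin] at this
      exact absurd l.2 (by omega)
    simpa [A.charpoly_natDegree_eq_dim] using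
      Polynomial.natDegree_modByMonic_lt (Polynomial.X ^ k) A.charpoly_monic hne
  rw [A.pow_eq_aeval_mod_charpoly k, Polynomial.aeval_eq_sum_range' hdeg, vecMul_sum,
    Finset.sum_apply]
  refine Finset.sum_eq_zero fun i hi => ?_
  rw [vecMul_smul, Pi.smul_apply, h i (Finset.mem_range.1 hi), smul_zero]

theorem notMem_colSupport_obsMat {n : ℕ} {A : Matrix (Fin n) (Fin n) ℂ} {c : Fin n → ℂ}
    {l : Fin n} : l ∉ colSupport (obsMat A c) ↔ ∀ k, vecMul c (A ^ k) l = 0 := by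
  have hmem : l ∈ colSupport (obsMat A c) ↔ ∃ k : Fin n, vecMul c (A ^ (k : ℕ)) l ≠ 0 := by
    unfold colSupport
    rw [@Finset.mem_filter _ _ (Classical.decPred _)]
    simp [obsMat]
  rw [hmem, not_exists]
  simp only [not_not]
  exact ⟨fun h => vecMul_pow_apply_eq_zero A c l fun k hk => h ⟨k, hk⟩, fun h k => h k⟩

/-- For an upper bidiagonal `A`, no entry leads from the column support of the observability
matrix to its complement. -/
theorem apply_eq_zero_of_mem_colSupport {n : ℕ} {A : Matrix (Fin n) (Fin n) ℂ}
    (hA : ∀ j j' : Fin n, (j' : ℕ) ≠ (j : ℕ) → (j' : ℕ) ≠ (j : ℕ) + 1 → A j j' = 0)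
    {c : Fin n → ℂ} {j l : Fin n} (hj : j ∈ colSupport (obsMat A c))
    (hl : l ∉ colSupport (obsMat A c)) : A j l = 0 := by
  by_contra hjl
  have hne : j ≠ l := fun e => hl (e ▸ hj)
  have hsucc : (l : ℕ) = j + 1 := by
    by_contra h
    exact hjl (hA j l (fun e => hne (Fin.ext e.symm)) h)
  refine notMem_colSupport_obsMat.2 (fun k => ?_) hj
  rw [notMem_colSupport_obsMat] at hl
  have h := hl (k + 1)
  rw [pow_succ, ← vecMul_vecMul, vecMul, dotProduct, Finset.sum_eq_single j] at h
  · exact (mul_eq_zero.1 h).resolve_right hjl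
  · intro b _ hb
    by_cases hbl : b = l
    · rw [hbl, hl k, zero_mul]
    · rw [hA b l (fun e => hbl (Fin.ext e.symm)) (fun e => hb (Fin.ext (by omega))), mul_zero]
  · simp

theorem selMatrix_mul_apply {n d : ℕ} (Q : Finset (Fin n)) (h : Q.card = d)
    (A : Matrix (Fin n) (Fin n) ℂ) (k : Fin d) (l : Fin n) :
    (selMatrix Q h * A) k l = A (Q.orderIsoOfFin h k) l := by
  rw [mul_apply, Finset.sum_eq_single (Q.orderIsoOfFin h k : Fin n)]
  · simp [selMatrix]
  · intro b _ hb
    rw [selMatrix, of_apply, if_neg hb, zero_mul]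
  · simp

theorem selMatrix_conjTranspose_mul_self {n d : ℕ} (Q : Finset (Fin n)) (h : Q.card = d) :
    (selMatrix Q h)ᴴ * selMatrix Q h = diagonal fun j => if j ∈ Q then 1 else 0 := by
  ext j l
  have hsum : ((selMatrix Q h)ᴴ * selMatrix Q h) j l =
      ∑ q : Q, (if j = q then 1 else 0) * (if l = q then 1 else 0) := by
    rw [mul_apply, ← (Q.orderIsoOfFin h).toEquiv.sum_comp]
    refine Finset.sum_congr rfl fun k _ => ?_
    rw [conjTranspose_apply, selMatrix, of_apply, of_apply, apply_ite star, star_one, star_zero]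
    rfl
  rw [hsum, Finset.sum_coe_sort Q fun q => (if j = q then (1 : ℂ) else 0) * if l = q then 1 else 0]
  by_cases hjl : j = l
  · subst hjl
    simp
  · simpa [diagonal_apply_ne _ hjl] using fun _ => hjl

/-- if `A` is in Jordan canonical form with every eigenvalue of geometric
multiplicity 1, then for each sensor `i`, with `Ã_i = H_i A H_iᴴ`, one has `Ã_i H_i = H_i A`. -/
theorem stmt4 {n m : ℕ} (A : Matrix (Fin n) (Fin n) ℂ) (hA : IsJordanGM1 A)
    (C : Matrix (Fin m) (Fin n) ℂ) (i : Fin m)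
    {d : ℕ} (hd : (colSupport (obsMat A (C i))).card = d)
    (Hi : Matrix (Fin d) (Fin n) ℂ) (hHi : Hi = selMatrix (colSupport (obsMat A (C i))) hd)
    (Atil : Matrix (Fin d) (Fin d) ℂ) (hAtil : Atil = Hi * A * Hiᴴ) :
    Atil * Hi = Hi * A := by
  subst hHi hAtil
  ext k l
  rw [Matrix.mul_assoc, selMatrix_conjTranspose_mul_self, mul_diagonal, selMatrix_mul_apply]
  split_ifs with hl
  · rw [mul_one]
  · rw [mul_zero, apply_eq_zero_of_mem_colSupport hA.1 (Subtype.prop _) hl]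
end

section
/- Suppose A ∈ ℂ^{n×n} is in Jordan canonical form with every eigenvalue of geometric multiplicity 1, and let C_i ∈ ℂ^{1×n} with Q_i nonempty. Then the reduced pair (Ã_i, C̃_i), where Ã_i := H_i A H_iᴴ ∈ ℂ^{n_i×n_i} and C̃_i := C_i H_iᴴ ∈ ℂ^{1×n_i}, is observable: the matrix whose k-th row is C̃_i Ã_i^{k-1} for k = 1,…,n_i has rank n_i. -/
open Matrix

/-- By Cayley–Hamilton, the first `n` observability equations imply all of them. -/
theorem vecMul_pow_dotProduct_eq_zero {n : ℕ} (A : Matrix (Fin n) (Fin n) ℂ) (c v : Fin n → ℂ)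
    (h : ∀ k : Fin n, c ᵥ* (A ^ (k : ℕ)) ⬝ᵥ v = 0) (k : ℕ) : c ᵥ* (A ^ k) ⬝ᵥ v = 0 := by
  rcases Nat.eq_zero_or_pos n with rfl | hn
  · simp [dotProduct]
  have : Nonempty (Fin n) := ⟨⟨0, hn⟩⟩
  let L : Matrix (Fin n) (Fin n) ℂ →ₗ[ℂ] ℂ :=
    { toFun := fun M => c ᵥ* M ⬝ᵥ v
      map_add' := fun M N => by rw [vecMul_add, add_dotProduct]
      map_smul' := fun a M => by rw [vecMul_smul, smul_dotProduct, RingHom.id_apply] }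
  change L (A ^ k) = 0
  rw [Matrix.pow_eq_aeval_mod_charpoly, Polynomial.aeval_eq_sum_range' (n := n), map_sum]
  · refine Finset.sum_eq_zero fun l hl => ?_
    rw [map_smul, show L (A ^ l) = 0 from h ⟨l, Finset.mem_range.1 hl⟩, smul_zero]
  · have hdeg : A.charpoly.natDegree = n := by simp
    exact (Polynomial.natDegree_modByMonic_lt _ A.charpoly_monic
      (fun h1 => by rw [h1, Polynomial.natDegree_one] at hdeg; omega)).trans_eq hdeg

/-- For upper bidiagonal `A`, entry `j` of `r * A` only involves the entries `j - 1`, `j` of `r`. -/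
theorem IsJordanGM1.vecMul_apply_of_succ {n : ℕ} {A : Matrix (Fin n) (Fin n) ℂ}
    (hA : IsJordanGM1 A) (r : Fin n → ℂ) {i j : Fin n} (hij : (j : ℕ) = i + 1) :
    (r ᵥ* A) j = r i * A i j + r j * A j j := by
  have hne : i ≠ j := by rintro rfl; omega
  rw [vecMul, dotProduct, Finset.sum_eq_add i j hne]
  · intro l _ hl
    rw [hA.1 l j (fun h => hl.2 (Fin.ext h.symm)) (fun h => hl.1 (Fin.ext (by omega))), mul_zero]
  · simp
  · simp

theorem IsJordanGM1.vecMul_apply_of_zero {n : ℕ} {A : Matrix (Fin n) (Fin n) ℂ}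
    (hA : IsJordanGM1 A) (r : Fin n → ℂ) {j : Fin n} (hj : (j : ℕ) = 0) :
    (r ᵥ* A) j = r j * A j j := by
  rw [vecMul, dotProduct, Finset.sum_eq_single j]
  · intro l _ hl
    rw [hA.1 l j (fun h => hl (Fin.ext h.symm)) (by omega), mul_zero]
  · simp

/-- If an entry of `r` is the first nonzero one in its Jordan block, then it is simply scaled by
`r ↦ r * A - μ r`. -/
theorem IsJordanGM1.vecMul_apply_of_forall_lt {n : ℕ} {A : Matrix (Fin n) (Fin n) ℂ}
    (hA : IsJordanGM1 A) (r : Fin n → ℂ) {j : Fin n}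
    (hj : ∀ i < j, A i i = A j j → r i = 0) : (r ᵥ* A) j = r j * A j j := by
  rcases Nat.eq_zero_or_pos (j : ℕ) with h0 | h0
  · exact hA.vecMul_apply_of_zero r h0
  · have hij : (j : ℕ) = ((⟨j - 1, by omega⟩ : Fin n) : ℕ) + 1 := by simp; omega
    rw [hA.vecMul_apply_of_succ r hij]
    rcases hA.2.1 _ _ hij with h | h
    · rw [h, mul_zero, zero_add]
    · rw [hj _ (Fin.lt_def.2 (by omega)) (hA.2.2.1 _ _ hij h), zero_mul, zero_add]

/-- In a family of row vectors stable under `r ↦ r * A - μ r`, a vector with a nonzero entry in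
the Jordan block of `q`, at or before `q`, yields one whose first nonzero entry is at `q`. -/
theorem IsJordanGM1.exists_leading_entry {n : ℕ} {A : Matrix (Fin n) (Fin n) ℂ}
    (hA : IsJordanGM1 A) {P : (Fin n → ℂ) → Prop} (hP : ∀ r (μ : ℂ), P r → P (r ᵥ* A - μ • r))
    (q : Fin n) (t : ℕ) (ht : t ≤ q) (r : Fin n → ℂ) (hr : P r)
    (hzero : ∀ j : Fin n, (j : ℕ) < t → r j = 0)
    (hne : ∃ j ≤ q, A j j = A q q ∧ r j ≠ 0) :
    ∃ s, P s ∧ s q ≠ 0 ∧ ∀ j < q, s j = 0 := by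
  induction ht using Nat.decreasingInduction generalizing r with
  | self =>
    obtain ⟨j, hjq, -, hj⟩ := hne
    obtain rfl : j = q := by
      by_contra h
      exact hj (hzero j (lt_of_le_of_ne hjq (Fin.val_ne_of_ne h)))
    exact ⟨r, hr, hj, hzero⟩
  | of_succ t ht ih =>
    let f : Fin n := ⟨t, by omega⟩
    have hf : ∀ j < f, r j = 0 := hzero
    have hscale : ∀ j : Fin n, (∀ i < j, A i i = A j j → r i = 0) →
        (r ᵥ* A - A f f • r) j = r j * (A j j - A f f) := by
      intro j hj
      rw [Pi.sub_apply, hA.vecMul_apply_of_forall_lt r hj, Pi.smul_apply, smul_eq_mul]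
      ring
    by_cases hrf : r f = 0
    · refine ih r hr (fun j hj => ?_) hne
      rcases (Nat.lt_succ_iff.1 hj).eq_or_lt with h | h
      · rwa [show j = f from Fin.ext h]
      · exact hzero j h
    refine ih _ (hP r (A f f) hr) (fun j hj => ?_) ?_
    · have hjf : j ≤ f := Fin.le_def.2 (Nat.lt_succ_iff.1 hj)
      rw [hscale j fun i hi _ => hf i (hi.trans_le hjf)]
      rcases hjf.eq_or_lt with rfl | h
      · simp
      · rw [hf j h, zero_mul]
    · by_cases hfq : A f f = A q q
      · have hfq' : f < q := ht
        have hsucc : ((⟨t + 1, by omega⟩ : Fin n) : ℕ) = f + 1 := rfl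
        have hle : (⟨t + 1, by omega⟩ : Fin n) ≤ q := ht
        have hone := hA.2.2.2 f q hfq' hfq f _ le_rfl hsucc hle
        have hdiag := hA.2.2.1 _ _ hsucc hone
        refine ⟨⟨t + 1, by omega⟩, hle, hdiag.symm.trans hfq, fun h => hrf ?_⟩
        rw [Pi.sub_apply, hA.vecMul_apply_of_succ r hsucc, hone, Pi.smul_apply, smul_eq_mul,
          ← hdiag] at h
        linear_combination h
      · classical
        have hex : (Finset.univ.filter fun j => j ≤ q ∧ A j j = A q q ∧ r j ≠ 0).Nonempty :=
          hne.imp fun j hj => by simpa using hj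
        obtain ⟨j, hj, hmin⟩ := Finset.exists_min_image _ id hex
        simp only [Finset.mem_filter, Finset.mem_univ, true_and, id] at hj hmin
        obtain ⟨hjq, hdiag, hrj⟩ := hj
        refine ⟨j, hjq, hdiag, ?_⟩
        rw [hscale j fun i hi hij => not_not.1 fun hri =>
          (hmin i ⟨hi.le.trans hjq, hij.trans hdiag, hri⟩).not_gt hi, hdiag]
        exact mul_ne_zero hrj (sub_ne_zero.2 (Ne.symm hfq))

theorem selMatrix_conjTranspose_apply {n d : ℕ} (Q : Finset (Fin n)) (h : Q.card = d)
    (j : Fin n) (k : Fin d) :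
    (selMatrix Q h)ᴴ j k = if j = (Q.orderIsoOfFin h k : Fin n) then 1 else 0 := by
  rw [conjTranspose_apply, selMatrix, of_apply, apply_ite star, star_one, star_zero]

theorem vecMul_selMatrix_conjTranspose {n d : ℕ} (Q : Finset (Fin n)) (h : Q.card = d)
    (r : Fin n → ℂ) (k : Fin d) :
    (r ᵥ* (selMatrix Q h)ᴴ) k = r (Q.orderIsoOfFin h k) := by
  rw [vecMul, dotProduct, Finset.sum_eq_single (Q.orderIsoOfFin h k : Fin n)]
  · rw [selMatrix_conjTranspose_apply, if_pos rfl, mul_one]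
  · intro j _ hj
    rw [selMatrix_conjTranspose_apply, if_neg hj, mul_zero]
  · simp

theorem selMatrix_conjTranspose_mulVec_coe {n d : ℕ} (Q : Finset (Fin n)) (h : Q.card = d)
    (v : Fin d → ℂ) (k : Fin d) :
    ((selMatrix Q h)ᴴ *ᵥ v) (Q.orderIsoOfFin h k) = v k := by
  simp [mulVec, dotProduct, selMatrix_conjTranspose_apply, -conjTranspose_apply]

theorem selMatrix_conjTranspose_mulVec_of_notMem {n d : ℕ} (Q : Finset (Fin n)) (h : Q.card = d)
    (v : Fin d → ℂ) {j : Fin n} (hj : j ∉ Q) :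
    ((selMatrix Q h)ᴴ *ᵥ v) j = 0 := by
  have hne (k : Fin d) : j ≠ Q.orderIsoOfFin h k := fun hk => hj (hk ▸ Subtype.property _)
  simp only [mulVec, dotProduct, selMatrix_conjTranspose_apply, if_neg (hne _), zero_mul,
    Finset.sum_const_zero]

theorem vecMul_selMatrix_conjTranspose_mul_selMatrix {n d : ℕ} (Q : Finset (Fin n))
    (h : Q.card = d) (r : Fin n → ℂ) (hr : ∀ j ∉ Q, r j = 0) :
    r ᵥ* (selMatrix Q h)ᴴ ᵥ* selMatrix Q h = r := by
  ext j
  rw [vecMul, dotProduct]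
  simp only [vecMul_selMatrix_conjTranspose]
  by_cases hj : j ∈ Q
  · obtain ⟨k, hk⟩ := (Q.orderIsoOfFin h).surjective ⟨j, hj⟩
    have hk' : j = Q.orderIsoOfFin h k := by rw [hk]
    subst hk'
    simp [selMatrix]
  · have hne (k : Fin d) : j ≠ Q.orderIsoOfFin h k := fun hk => hj (hk ▸ Subtype.property _)
    simp only [selMatrix, of_apply, if_neg (hne _), mul_zero, Finset.sum_const_zero, hr j hj]

theorem vecMul_pow_apply_eq_zero_of_notMem {n : ℕ} {A : Matrix (Fin n) (Fin n) ℂ} {c : Fin n → ℂ}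
    {j : Fin n} (hj : j ∉ colSupport (obsMat A c)) (k : ℕ) : (c ᵥ* (A ^ k)) j = 0 := by
  rw [mem_colSupport] at hj
  push Not at hj
  simpa using vecMul_pow_dotProduct_eq_zero A c (Pi.single j 1) (fun k => by simpa [obsMat] using hj k) k

/-- The nonzero columns of the observability matrix are linearly independent. -/
theorem IsJordanGM1.eq_zero_of_forall_dotProduct_eq_zero {n : ℕ} {A : Matrix (Fin n) (Fin n) ℂ}
    (hA : IsJordanGM1 A) {c w : Fin n → ℂ} (hw : ∀ j ∉ colSupport (obsMat A c), w j = 0)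
    (h : ∀ k : ℕ, c ᵥ* (A ^ k) ⬝ᵥ w = 0) : w = 0 := by
  classical
  by_contra hw0
  obtain ⟨j, hj⟩ := Function.ne_iff.1 hw0
  obtain ⟨q, hq, hmax⟩ := (Finset.univ.filter fun j => w j ≠ 0).exists_max_image id
    ⟨j, by simpa using hj⟩
  simp only [Finset.mem_filter, Finset.mem_univ, true_and, id] at hq hmax
  obtain ⟨k, hk⟩ := mem_colSupport.1 (not_imp_comm.1 (hw q) hq)
  obtain ⟨s, hs, hsq, hlt⟩ := hA.exists_leading_entry
    (P := fun r => ∀ k : ℕ, r ᵥ* (A ^ k) ⬝ᵥ w = 0)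
    (fun r μ hr k => by
      rw [sub_vecMul, smul_vecMul, sub_dotProduct, smul_dotProduct, vecMul_vecMul, ← pow_succ',
        hr, hr, smul_zero, sub_zero])
    q 0 (Nat.zero_le _) (c ᵥ* (A ^ (k : ℕ)))
    (fun l => by rw [vecMul_vecMul, ← pow_add, h])
    (fun j hj => absurd hj (Nat.not_lt_zero _)) ⟨q, le_rfl, rfl, hk⟩
  have h0 := hs 0
  rw [pow_zero, vecMul_one, dotProduct, Finset.sum_eq_single q] at h0
  · exact mul_ne_zero hsq hq h0
  · intro j _ hjq
    rcases lt_or_gt_of_ne hjq with hlt' | hgt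
    · rw [hlt j hlt', zero_mul]
    · rw [not_not.1 fun hj => (hmax j hj).not_gt hgt, mul_zero]
  · simp

/-- Passing to the indices in `colSupport` commutes with taking observability rows. -/
theorem vecMul_selMatrix_pow {n d : ℕ} (A : Matrix (Fin n) (Fin n) ℂ) (c : Fin n → ℂ)
    (hd : (colSupport (obsMat A c)).card = d) (H : Matrix (Fin d) (Fin n) ℂ)
    (hH : H = selMatrix (colSupport (obsMat A c)) hd) (k : ℕ) :
    c ᵥ* Hᴴ ᵥ* ((H * A * Hᴴ) ^ k) = c ᵥ* (A ^ k) ᵥ* Hᴴ := by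
  induction k with
  | zero => simp
  | succ k ih =>
    rw [pow_succ, ← vecMul_vecMul, ih, ← vecMul_vecMul, ← vecMul_vecMul]
    nth_rewrite 2 [hH]
    nth_rewrite 1 [hH]
    rw [vecMul_selMatrix_conjTranspose_mul_selMatrix _ _ _
      fun j hj => vecMul_pow_apply_eq_zero_of_notMem hj k, vecMul_vecMul c, ← pow_succ]

/-- if `A` is in Jordan canonical form with every eigenvalue of geometric
multiplicity 1 and `Q_i` is nonempty, then the reduced pair `(Ã_i, C̃_i)`, where
`Ã_i := H_i A H_iᴴ` and `C̃_i := C_i H_iᴴ`, is observable: the matrix whose `k`-th row is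
`C̃_i Ã_i^{k-1}` for `k = 1,…,n_i` has rank `n_i`. -/
theorem stmt7 {n m : ℕ} (A : Matrix (Fin n) (Fin n) ℂ) (hA : IsJordanGM1 A)
    (C : Matrix (Fin m) (Fin n) ℂ) (i : Fin m)
    {d : ℕ} (hd : (colSupport (obsMat A (C i))).card = d) (hd1 : 1 ≤ d)
    (Hi : Matrix (Fin d) (Fin n) ℂ) (hHi : Hi = selMatrix (colSupport (obsMat A (C i))) hd)
    (Atil : Matrix (Fin d) (Fin d) ℂ) (hAtil : Atil = Hi * A * Hiᴴ)
    (ctil : Fin d → ℂ) (hctil : ctil = Matrix.vecMul (C i) Hiᴴ) :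
    Matrix.rank (Matrix.of fun (k l : Fin d) => Matrix.vecMul ctil (Atil ^ (k : ℕ)) l) = d := by
  subst hAtil hctil
  rw [rank_of_isUnit, Fintype.card_fin]
  rw [← mulVec_injective_iff_isUnit, ← coe_mulVecLin, injective_iff_map_eq_zero]
  intro v hv
  have hobs := vecMul_pow_dotProduct_eq_zero _ _ v fun k => congrFun hv k
  have hw : Hiᴴ *ᵥ v = 0 := by
    refine hA.eq_zero_of_forall_dotProduct_eq_zero (c := C i) (fun j hj => ?_) fun k => ?_
    · rw [hHi]
      exact selMatrix_conjTranspose_mulVec_of_notMem _ hd v hj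
    · rw [dotProduct_mulVec, ← vecMul_selMatrix_pow A (C i) hd Hi hHi]
      exact hobs k
  ext l
  rw [← selMatrix_conjTranspose_mulVec_coe _ hd v l, ← hHi, hw]
  rfl
end

section
/- Let N, p be natural numbers with N ≥ 2p + 1, let a_1, …, a_N ∈ ℝ, c ∈ ℝ, and γ ≥ 0, and suppose the number of indices i with |a_i − c| > γ is at most p. Then every global minimizer t ∈ ℝ of the function s ↦ Σ_{i=1}^N |a_i − s| satisfies |t − c| ≤ γ. -/
/-- If moving from `s` to `t` increases the distance to every point outside a minority set `B` of
indices by the full `|t - s|`, then the sum of absolute deviations is strictly larger at `t`. -/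
theorem sum_abs_sub_lt_of_minority {ι : Type*} [Fintype ι] (a : ι → ℝ) (B : Finset ι)
    (hB : 2 * B.card < Fintype.card ι) {s t : ℝ} (hst : s ≠ t)
    (h : ∀ i, i ∉ B → |a i - s| + |t - s| ≤ |a i - t|) :
    ∑ i, |a i - s| < ∑ i, |a i - t| := by
  classical
  have hterm : ∀ i, |a i - s| + (|t - s| - if i ∈ B then 2 * |t - s| else 0) ≤ |a i - t| := by
    intro i
    split_ifs with hi
    · linarith [abs_sub_le (a i) t s]
    · simpa using h i hi
  have hsum := Finset.sum_le_sum fun i (_ : i ∈ Finset.univ) => hterm i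
  simp only [Finset.sum_add_distrib, Finset.sum_sub_distrib, Finset.sum_const, Finset.card_univ,
    Finset.sum_ite_mem, Finset.univ_inter, nsmul_eq_mul] at hsum
  have hd : 0 < |t - s| := abs_pos.mpr (sub_ne_zero.mpr hst.symm)
  have hB' : (2 * B.card : ℝ) < Fintype.card ι := by exact_mod_cast hB
  nlinarith [mul_pos (sub_pos.mpr hB') hd]

/-- robust median fact: let `N ≥ 2p + 1`, `a_1, …, a_N ∈ ℝ`, `c ∈ ℝ`,
`γ ≥ 0`, and suppose at most `p` indices satisfy `|a_i − c| > γ`. Then every global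
minimizer `t` of `s ↦ ∑_i |a_i − s|` satisfies `|t − c| ≤ γ`. -/
theorem stmt10 {N p : ℕ} (hN : 2 * p + 1 ≤ N) (a : Fin N → ℝ) (c γ : ℝ) (hγ : 0 ≤ γ)
    (hcount : (Finset.univ.filter fun i => γ < |a i - c|).card ≤ p)
    (t : ℝ) (hmin : ∀ s : ℝ, ∑ i, |a i - t| ≤ ∑ i, |a i - s|) :
    |t - c| ≤ γ := by
  by_contra! ht
  have hB : 2 * (Finset.univ.filter fun i => γ < |a i - c|).card < Fintype.card (Fin N) := by
    rw [Fintype.card_fin]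
    omega
  rcases lt_abs.mp ht with h | h
  · refine (hmin (c + γ)).not_gt (sum_abs_sub_lt_of_minority a _ hB (by grind) fun i hi => ?_)
    have hi' : |a i - c| ≤ γ := by simpa using hi
    have := (abs_le.mp hi').2
    rw [abs_of_nonpos (by linarith : a i - (c + γ) ≤ 0),
      abs_of_nonneg (by linarith : 0 ≤ t - (c + γ)), abs_of_nonpos (by linarith : a i - t ≤ 0)]
    linarith
  · refine (hmin (c - γ)).not_gt (sum_abs_sub_lt_of_minority a _ hB (by grind) fun i hi => ?_)
    have hi' : |a i - c| ≤ γ := by simpa using hi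
    have := (abs_le.mp hi').1
    rw [abs_of_nonneg (by linarith : 0 ≤ a i - (c - γ)),
      abs_of_nonpos (by linarith : t - (c - γ) ≤ 0), abs_of_nonneg (by linarith : 0 ≤ a i - t)]
    linarith
end

section
/- Let A ∈ ℂ^{n×n} and C ∈ ℂ^{m×n} with n ≥ 1, and let p ≥ 0 with 2p ≤ m. Suppose (A, C) is 2p-sparse observable, i.e., for every subset 𝒞 ⊆ {1,…,m} with |𝒞| = 2p, the pair (A, C_{{1,…,m}∖𝒞}) is observable. Then for every j ∈ {1,…,n}, the number of sensors i ∈ {1,…,m} such that the j-th column of the observability matrix O_i := O(A, C_i) is nonzero is at least 2p + 1. -/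
open Matrix

/-- The pair `(A, C)` (with sensor index set `ι`) is observable: the stacked matrix with
rows `C_i · A^k` (`i ∈ ι`, `k = 0,…,n-1`) has rank `n`. -/
noncomputable def IsObservable {n : ℕ} {ι : Type*} [Fintype ι]
    (A : Matrix (Fin n) (Fin n) ℂ) (C : Matrix ι (Fin n) ℂ) : Prop :=
  Matrix.rank
    (Matrix.of fun (q : ι × Fin n) (j : Fin n) => Matrix.vecMul (C q.1) (A ^ (q.2 : ℕ)) j) = n

/-- A matrix whose rank equals its number of columns has no zero column. -/
theorem Matrix.col_ne_zero_of_rank_eq_card {K m n : Type*} [Field K] [Fintype n]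
    {M : Matrix m n K} (h : M.rank = Fintype.card n) (j : n) : M.col j ≠ 0 := by
  have hli : LinearIndependent K M.col := by
    rw [linearIndependent_iff_card_eq_finrank_span, Set.finrank, ← M.rank_eq_finrank_span_cols, h]
  exact hli.ne_zero j

/-- if `n ≥ 1`, `2p ≤ m`, and `(A, C)` is `2p`-sparse observable (i.e.,
`(A, C_{{1,…,m}∖𝒞})` is observable for every `𝒞` with `|𝒞| = 2p`), then for every state
index `j`, the number of sensors `i` whose observability matrix `O_i` has a nonzero `j`-th
column is at least `2p + 1`. -/
theorem stmt13 {n m : ℕ} (hn : 1 ≤ n)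
    (A : Matrix (Fin n) (Fin n) ℂ) (C : Matrix (Fin m) (Fin n) ℂ)
    (p : ℕ) (hp : 2 * p ≤ m)
    (hobs : ∀ 𝒞 : Finset (Fin m), 𝒞.card = 2 * p →
      IsObservable A (Matrix.of fun (s : {i : Fin m // i ∈ 𝒞ᶜ}) (j : Fin n) => C s.1 j)) :
    ∀ j : Fin n,
      2 * p + 1 ≤ (Finset.univ.filter fun i : Fin m => j ∈ colSupport (obsMat A (C i))).card := by
  intro j
  by_contra! hlt
  obtain ⟨S, hsub, hcard⟩ := Finset.exists_superset_card_eq (Nat.le_of_lt_succ hlt)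
    (by simpa using hp)
  refine Matrix.col_ne_zero_of_rank_eq_card ((hobs S hcard).trans (Fintype.card_fin n).symm) j ?_
  ext ⟨⟨i, hi⟩, k⟩
  by_contra hne
  exact Finset.mem_compl.mp hi
    (hsub (Finset.mem_filter.mpr ⟨Finset.mem_univ i, mem_colSupport.mpr ⟨k, hne⟩⟩))
end

section
/- Let I be a finite nonempty index set and for each i ∈ I let Ã_i ∈ ℝ^{n_i×n_i} and C̃_i ∈ ℝ^{1×n_i} with n_i ≥ 1, and let B_w > 0 and B_v ≥ 0. Then the following are equivalent: (1) there exist γ > 0 and gains L_i ∈ ℝ^{n_i×1} (i ∈ I) such that for every i, γ ≥ B_w + ‖L_i‖₂ B_v and σ_max(Ã_i − L_i C̃_i) ≤ (γ − B_w − ‖L_i‖₂ B_v)/((2√n_i + 1) γ); (2) for every i ∈ I there exists L ∈ ℝ^{n_i×1} with σ_max(Ã_i − L C̃_i) < 1/(2√n_i + 1). -/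
open Matrix

/-- The Euclidean (2-)norm of a real vector. -/
noncomputable def vnorm2 {n : ℕ} (x : Fin n → ℝ) : ℝ := Real.sqrt (∑ j, (x j) ^ 2)

/-- The induced 2-norm (largest singular value) of a real matrix. -/
noncomputable def mat2Norm {p q : ℕ} (M : Matrix (Fin p) (Fin q) ℝ) : ℝ :=
  ‖LinearMap.toContinuousLinearMap (Matrix.toEuclideanLin M)‖

/-- Proposition 7: for a finite nonempty index set (encoded as `Fin m`,
`m ≥ 1`) of local systems `(Ã_i, C̃_i)` with `n_i ≥ 1`, `B_w > 0` and `B_v ≥ 0`, the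
following are equivalent: (1) there exist `γ > 0` and gains `L_i` such that for every `i`,
`γ ≥ B_w + ‖L_i‖₂ B_v` and `σ_max(Ã_i − L_i C̃_i) ≤ (γ − B_w − ‖L_i‖₂ B_v)/((2√n_i + 1)γ)`;
(2) for every `i` there exists `L` with `σ_max(Ã_i − L C̃_i) < 1/(2√n_i + 1)`. -/
theorem stmt17 {m : ℕ} (hm : 1 ≤ m) (d : Fin m → ℕ) (hd : ∀ i, 1 ≤ d i)
    (Atil : ∀ i, Matrix (Fin (d i)) (Fin (d i)) ℝ) (ctil : ∀ i, Fin (d i) → ℝ)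
    (Bw : ℝ) (hBw : 0 < Bw) (Bv : ℝ) (hBv : 0 ≤ Bv) :
    (∃ γ : ℝ, 0 < γ ∧ ∃ L : ∀ i, Fin (d i) → ℝ, ∀ i,
        Bw + vnorm2 (L i) * Bv ≤ γ ∧
        mat2Norm (Atil i - Matrix.vecMulVec (L i) (ctil i))
          ≤ (γ - Bw - vnorm2 (L i) * Bv) / ((2 * Real.sqrt (d i) + 1) * γ)) ↔
    (∀ i, ∃ L : Fin (d i) → ℝ,
        mat2Norm (Atil i - Matrix.vecMulVec L (ctil i)) < 1 / (2 * Real.sqrt (d i) + 1)) := by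
  constructor
  · rintro ⟨γ, hγ, L, h⟩ i
    refine ⟨L i, (h i).2.trans_lt ?_⟩
    have hL : 0 ≤ vnorm2 (L i) * Bv := mul_nonneg (Real.sqrt_nonneg _) hBv
    have hk : 0 < 2 * Real.sqrt (d i) + 1 := by positivity
    rw [div_lt_div_iff₀ (by positivity) hk]
    nlinarith [mul_pos hk hBw, mul_nonneg hk.le hL]
  · intro h
    choose L hL using h
    have hev : ∀ᶠ γ : ℝ in Filter.atTop, ∀ i,
        (Bw + vnorm2 (L i) * Bv) /
          (1 - mat2Norm (Atil i - Matrix.vecMulVec (L i) (ctil i)) *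
            (2 * Real.sqrt (d i) + 1)) ≤ γ :=
      Filter.eventually_all.2 fun i => Filter.eventually_ge_atTop _
    obtain ⟨γ, hγ, hbound⟩ := ((Filter.eventually_gt_atTop (0 : ℝ)).and hev).exists
    refine ⟨γ, hγ, L, fun i => ?_⟩
    have hk : 0 < 2 * Real.sqrt (d i) + 1 := by positivity
    have hσ : 0 ≤ mat2Norm (Atil i - Matrix.vecMulVec (L i) (ctil i)) := norm_nonneg _
    have hgap := (lt_div_iff₀ hk).1 (hL i)
    have hle := (div_le_iff₀ (sub_pos.2 hgap)).1 (hbound i)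
    refine ⟨?_, ?_⟩
    · nlinarith [mul_nonneg hγ.le (mul_nonneg hσ hk.le)]
    · rw [le_div_iff₀ (by positivity)]
      linarith
end
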